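/- arXiv:1502.01801 — 7 statements merged into one kernel-verified Lean document; each statement's English description precedes it below -/
import Mathlib

section
/- Let f : ℝ^n → ℝ^n be continuously differentiable with Jacobian J_f, let S ⊆ ℝ^n be a convex set, and let b ∈ ℝ be such that for every x ∈ S the symmetric part of the Jacobian satisfies J_f(x) + J_f(x)ᵀ ⪯ 2b·I (i.e., vᵀ(J_f(x)+J_f(x)ᵀ)v ≤ 2b‖v‖² for all v ∈ ℝ^n). Let ξ(x₁,·) and ξ(x₂,·) be two trajectories of ẋ = f(x) such that ξ(x₁,t) ∈ S and ξ(x₂,t) ∈ S for all t in an interval [t₀,t₁]. Define y(t) = ξ(x₂,t) − ξ(x₁,t). Then for every t ∈ [t₀,t₁], the derivative of ‖y(t)‖² satisfies d/dt ‖y(t)‖² ≤ 2b · ‖y(t)‖². -/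
open Set
open scoped Matrix

/-- **Differential inequality for the squared distance between trajectories.**
Let `f : ℝⁿ → ℝⁿ` be `C¹` with Jacobian `J`, let `S` be convex, and suppose
`J(x) + J(x)ᵀ ⪯ 2b·I` on `S` (i.e. `vᵀ(J(x)+J(x)ᵀ)v ≤ 2b‖v‖²`).  If two trajectories
`ξ(x₁,·)`, `ξ(x₂,·)` of `ẋ = f(x)` stay in `S` on `[t₀,t₁]`, then with
`y(t) = ξ(x₂,t) − ξ(x₁,t)`, for every `t ∈ [t₀,t₁]`,
`d/dt ‖y(t)‖² ≤ 2b·‖y(t)‖²`. -/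
theorem sq_dist_deriv_le
    {n : ℕ} (f : EuclideanSpace ℝ (Fin n) → EuclideanSpace ℝ (Fin n))
    (J : EuclideanSpace ℝ (Fin n) → Matrix (Fin n) (Fin n) ℝ)
    (hf : ContDiff ℝ 1 f)
    (hJ : ∀ x v : EuclideanSpace ℝ (Fin n), fderiv ℝ f x v = (J x).mulVec v)
    (S : Set (EuclideanSpace ℝ (Fin n))) (hS : Convex ℝ S)
    (b : ℝ)
    (hb : ∀ x ∈ S, ∀ v : EuclideanSpace ℝ (Fin n),
      v ⬝ᵥ (J x + (J x)ᵀ).mulVec v ≤ 2 * b * ‖v‖ ^ 2)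
    (ξ : EuclideanSpace ℝ (Fin n) → ℝ → EuclideanSpace ℝ (Fin n))
    (x₁ x₂ : EuclideanSpace ℝ (Fin n))
    (hξ₁ : ∀ t : ℝ, HasDerivAt (ξ x₁) (f (ξ x₁ t)) t)
    (hξ₂ : ∀ t : ℝ, HasDerivAt (ξ x₂) (f (ξ x₂ t)) t)
    (t₀ t₁ : ℝ)
    (hS₁ : ∀ t ∈ Icc t₀ t₁, ξ x₁ t ∈ S)
    (hS₂ : ∀ t ∈ Icc t₀ t₁, ξ x₂ t ∈ S) :
    ∀ t ∈ Icc t₀ t₁, ∀ d : ℝ,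
      HasDerivAt (fun s => ‖ξ x₂ s - ξ x₁ s‖ ^ 2) d t →
        d ≤ 2 * b * ‖ξ x₂ t - ξ x₁ t‖ ^ 2 := by
  intro t ht d hd
  have hquad : ∀ x ∈ S, ∀ v : EuclideanSpace ℝ (Fin n),
      inner ℝ v (fderiv ℝ f x v) ≤ b * ‖v‖ ^ 2 := by
    intro x hx v
    have h1 := hb x hx v
    have h2 : inner ℝ v (fderiv ℝ f x v) = v.ofLp ⬝ᵥ (J x).mulVec v.ofLp := by
      rw [← hJ, EuclideanSpace.inner_eq_star_dotProduct, dotProduct_comm]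
      simp
    have h3 : v.ofLp ⬝ᵥ ((J x)ᵀ).mulVec v.ofLp = v.ofLp ⬝ᵥ (J x).mulVec v.ofLp := by
      rw [Matrix.mulVec_transpose, dotProduct_comm, Matrix.dotProduct_mulVec]
    rw [Matrix.add_mulVec, dotProduct_add, h3, ← h2] at h1
    linarith
  have hd' : HasDerivAt (fun s => ‖ξ x₂ s - ξ x₁ s‖ ^ 2)
      (2 * inner ℝ (ξ x₂ t - ξ x₁ t) (f (ξ x₂ t) - f (ξ x₁ t))) t :=
    ((hξ₂ t).sub (hξ₁ t)).norm_sq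
  rw [hd.unique hd']
  have hp := hS₁ t ht
  have hq := hS₂ t ht
  generalize ξ x₁ t = p at hp ⊢
  generalize ξ x₂ t = q at hq ⊢
  have hg : ∀ s : ℝ, HasDerivAt (fun s : ℝ => inner ℝ (q - p) (f (p + s • (q - p))))
      (inner ℝ (q - p) (fderiv ℝ f (p + s • (q - p)) (q - p))) s := by
    intro s
    have hl : HasDerivAt (fun s : ℝ => p + s • (q - p)) (q - p) s := by
      simpa using ((hasDerivAt_id s).smul_const (q - p)).const_add p
    have hc : HasDerivAt (fun s : ℝ => f (p + s • (q - p)))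
        (fderiv ℝ f (p + s • (q - p)) (q - p)) s :=
      ((hf.differentiable one_ne_zero _).hasFDerivAt).comp_hasDerivAt s hl
    simpa using (hasDerivAt_const s (q - p)).inner ℝ hc
  obtain ⟨s, hs, he⟩ := exists_hasDerivAt_eq_slope _ _ (zero_lt_one' ℝ)
    (fun s _ => (hg s).continuousAt.continuousWithinAt) (fun s _ => hg s)
  have hm : p + s • (q - p) ∈ S := hS.add_smul_sub_mem hp hq ⟨hs.1.le, hs.2.le⟩
  have h4 := hquad _ hm (q - p)
  rw [he] at h4
  simp only [one_smul, zero_smul, add_zero, sub_zero, div_one, add_sub_cancel,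
    ← inner_sub_right] at h4
  linarith
end

section
/- Let f : ℝ^n → ℝ^n be continuously differentiable with Jacobian J_f, let S ⊆ ℝ^n be a convex set, and let b ∈ ℝ be such that for every x ∈ S, J_f(x) + J_f(x)ᵀ ⪯ 2b·I. Let ξ(x₁,·) and ξ(x₂,·) be two trajectories of ẋ = f(x) with ξ(x₁,t₀) = x₁, ξ(x₂,t₀) = x₂, and suppose ξ(x₁,t), ξ(x₂,t) ∈ S for all t ∈ [t₀,t₁]. Then for every t ∈ [t₀,t₁], ‖ξ(x₁,t) − ξ(x₂,t)‖ ≤ ‖x₁ − x₂‖ · e^{b(t−t₀)}. -/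
open Set
open scoped Matrix

theorem quad_bound_aux {n : ℕ} (A : Matrix (Fin n) (Fin n) ℝ) (v w : EuclideanSpace ℝ (Fin n))
    (c : ℝ) (hw : (w : Fin n → ℝ) = A.mulVec v)
    (h : v ⬝ᵥ (A + Aᵀ).mulVec v ≤ 2 * c) : inner ℝ v w ≤ c := by
  have h1 : inner ℝ v w = (v : Fin n → ℝ) ⬝ᵥ A.mulVec v := by
    rw [← hw, EuclideanSpace.inner_eq_star_dotProduct, dotProduct_comm]
    simp
  have h2 : (v : Fin n → ℝ) ⬝ᵥ Aᵀ.mulVec v = (v : Fin n → ℝ) ⬝ᵥ A.mulVec v := by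
    rw [Matrix.mulVec_transpose, dotProduct_comm, Matrix.dotProduct_mulVec]
  rw [Matrix.add_mulVec, dotProduct_add, h2] at h
  linarith

theorem one_sided_aux {E : Type*} [NormedAddCommGroup E] [InnerProductSpace ℝ E]
    (f : E → E) (hf : Differentiable ℝ f) (S : Set E) (hS : Convex ℝ S) (b : ℝ)
    (hb : ∀ x ∈ S, ∀ v, inner ℝ v (fderiv ℝ f x v) ≤ b * ‖v‖ ^ 2)
    (x y : E) (hx : x ∈ S) (hy : y ∈ S) :
    inner ℝ (x - y) (f x - f y) ≤ b * ‖x - y‖ ^ 2 := by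
  have hd : ∀ s : ℝ, HasDerivAt (fun s : ℝ => inner ℝ (x - y) (f (y + s • (x - y))))
      (inner ℝ (x - y) (fderiv ℝ f (y + s • (x - y)) (x - y))) s := by
    intro s
    have h1 : HasDerivAt (fun s : ℝ => y + s • (x - y)) (x - y) s := by
      simpa using ((hasDerivAt_id s).smul_const (x - y)).const_add y
    have h2 := (hf (y + s • (x - y))).hasFDerivAt.comp_hasDerivAt s h1
    simpa using (hasDerivAt_const s (x - y)).inner ℝ h2
  have h := (convex_Icc (0 : ℝ) 1).image_sub_le_mul_sub_of_deriv_le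
    (f := fun s : ℝ => inner ℝ (x - y) (f (y + s • (x - y)))) (C := b * ‖x - y‖ ^ 2)
    (fun s _ => (hd s).continuousAt.continuousWithinAt)
    (fun s _ => (hd s).differentiableAt.differentiableWithinAt)
    (fun s hs => by
      rw [(hd s).deriv]
      exact hb _ (hS.add_smul_sub_mem hy hx (interior_subset hs)) _)
    0 (by simp) 1 (by simp) zero_le_one
  simpa [inner_sub_right] using h

/-- **One-step exponential discrepancy bound.** Let `f : ℝⁿ → ℝⁿ` be `C¹` with Jacobian
`J`, let `S` be convex, and suppose `J(x) + J(x)ᵀ ⪯ 2b·I` on `S`.  If two trajectories of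
`ẋ = f(x)` start at time `t₀` from `x₁` and `x₂` and stay in `S` on `[t₀,t₁]`, then for
every `t ∈ [t₀,t₁]`, `‖ξ(x₁,t) − ξ(x₂,t)‖ ≤ ‖x₁ − x₂‖·e^{b(t−t₀)}`. -/
theorem local_discrepancy_one_step
    {n : ℕ} (f : EuclideanSpace ℝ (Fin n) → EuclideanSpace ℝ (Fin n))
    (J : EuclideanSpace ℝ (Fin n) → Matrix (Fin n) (Fin n) ℝ)
    (hf : ContDiff ℝ 1 f)
    (hJ : ∀ x v : EuclideanSpace ℝ (Fin n), fderiv ℝ f x v = (J x).mulVec v)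
    (S : Set (EuclideanSpace ℝ (Fin n))) (hS : Convex ℝ S)
    (b : ℝ)
    (hb : ∀ x ∈ S, ∀ v : EuclideanSpace ℝ (Fin n),
      v ⬝ᵥ (J x + (J x)ᵀ).mulVec v ≤ 2 * b * ‖v‖ ^ 2)
    (ξ : EuclideanSpace ℝ (Fin n) → ℝ → EuclideanSpace ℝ (Fin n))
    (x₁ x₂ : EuclideanSpace ℝ (Fin n))
    (hξ₁ : ∀ t : ℝ, HasDerivAt (ξ x₁) (f (ξ x₁ t)) t)
    (hξ₂ : ∀ t : ℝ, HasDerivAt (ξ x₂) (f (ξ x₂ t)) t)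
    (t₀ t₁ : ℝ)
    (hinit₁ : ξ x₁ t₀ = x₁) (hinit₂ : ξ x₂ t₀ = x₂)
    (hS₁ : ∀ t ∈ Icc t₀ t₁, ξ x₁ t ∈ S)
    (hS₂ : ∀ t ∈ Icc t₀ t₁, ξ x₂ t ∈ S) :
    ∀ t ∈ Icc t₀ t₁,
      ‖ξ x₁ t - ξ x₂ t‖ ≤ ‖x₁ - x₂‖ * Real.exp (b * (t - t₀)) := by
  have hb' : ∀ x ∈ S, ∀ v, inner ℝ v (fderiv ℝ f x v) ≤ b * ‖v‖ ^ 2 := fun x hx v =>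
    quad_bound_aux (J x) v _ _ (hJ x v) (by have := hb x hx v; linarith)
  have hos := one_sided_aux f (hf.differentiable (by norm_num)) S hS b hb'
  have hd : ∀ t : ℝ, HasDerivAt
      (fun t => ‖ξ x₁ t - ξ x₂ t‖ ^ 2 * Real.exp (-(2 * b * (t - t₀))))
      (2 * inner ℝ (ξ x₁ t - ξ x₂ t) (f (ξ x₁ t) - f (ξ x₂ t)) * Real.exp (-(2 * b * (t - t₀)))
        + ‖ξ x₁ t - ξ x₂ t‖ ^ 2 * (Real.exp (-(2 * b * (t - t₀))) * (-(2 * b)))) t := by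
    intro t
    have h1 := ((hξ₁ t).sub (hξ₂ t)).norm_sq
    have h2 : HasDerivAt (fun t => -(2 * b * (t - t₀))) (-(2 * b)) t := by
      simpa using (((hasDerivAt_id t).sub_const t₀).const_mul (2 * b)).fun_neg
    exact h1.mul h2.exp
  have hanti : AntitoneOn (fun t => ‖ξ x₁ t - ξ x₂ t‖ ^ 2 * Real.exp (-(2 * b * (t - t₀))))
      (Icc t₀ t₁) := by
    refine antitoneOn_of_deriv_nonpos (convex_Icc _ _)
      (fun s _ => (hd s).continuousAt.continuousWithinAt)
      (fun s _ => (hd s).differentiableAt.differentiableWithinAt) (fun s hs => ?_)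
    have hs' := interior_subset hs
    rw [(hd s).deriv]
    have h1 := hos _ _ (hS₁ s hs') (hS₂ s hs')
    have h2 := mul_le_mul_of_nonneg_right h1 (Real.exp_pos (-(2 * b * (s - t₀)))).le
    linarith
  intro t ht
  have h := hanti (left_mem_Icc.2 (ht.1.trans ht.2)) ht ht.1
  simp only [hinit₁, hinit₂, sub_self, mul_zero, neg_zero, Real.exp_zero, mul_one] at h
  refine (sq_le_sq₀ (norm_nonneg _) (by positivity)).1 ?_
  have h3 := mul_le_mul_of_nonneg_right h (Real.exp_pos (2 * b * (t - t₀))).le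
  rw [mul_assoc, ← Real.exp_add, neg_add_cancel, Real.exp_zero, mul_one] at h3
  rw [mul_pow, ← Real.exp_nat_mul]
  convert h3 using 3
  push_cast
  ring
end

section
/- Let f : ℝ^n → ℝ^n be continuously differentiable with Jacobian J_f, let 0 = t₀ < t₁ < … < t_k = T be a partition of [0,T], and for each i ∈ {1,…,k} let S_i ⊆ ℝ^n be a convex set and b_i ∈ ℝ a constant such that J_f(x) + J_f(x)ᵀ ⪯ 2b_i·I for all x ∈ S_i. Let ξ(x₁,·) and ξ(x₂,·) be two trajectories of ẋ = f(x) starting at time t₀ from x₁ and x₂, and suppose that for each i and every t ∈ [t_{i−1},t_i], both ξ(x₁,t) ∈ S_i and ξ(x₂,t) ∈ S_i. Then for each i ∈ {1,…,k} and every t ∈ [t_{i−1},t_i], ‖ξ(x₁,t) − ξ(x₂,t)‖ ≤ ‖x₁ − x₂‖ · exp( b_i(t − t_{i−1}) + Σ_{j=1}^{i−1} b_j(t_j − t_{j−1}) ). In particular the piece-wise exponential function β(x₁,x₂,t) = ‖x₁−x₂‖ exp(b_i(t−t_{i−1}) + Σ_{j<i} b_j(t_j−t_{j−1})) is an upper bound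 on the distance between the two trajectories on all of [0,T]. -/
open Set
open scoped Matrix

theorem one_sided_lip {n : ℕ} (f : EuclideanSpace ℝ (Fin n) → EuclideanSpace ℝ (Fin n))
    (hf : ContDiff ℝ 1 f) (S : Set (EuclideanSpace ℝ (Fin n))) (hS : Convex ℝ S) (b : ℝ)
    (hb : ∀ x ∈ S, ∀ v, inner ℝ v (fderiv ℝ f x v) ≤ b * ‖v‖ ^ 2)
    (x y : EuclideanSpace ℝ (Fin n)) (hx : x ∈ S) (hy : y ∈ S) :
    inner ℝ (x - y) (f x - f y) ≤ b * ‖x - y‖ ^ 2 := by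
  have hd : ∀ s : ℝ, HasDerivAt (fun s : ℝ => inner ℝ (x - y) (f (y + s • (x - y))))
      (inner ℝ (x - y) (fderiv ℝ f (y + s • (x - y)) (x - y))) s := by
    intro s
    have h1 : HasDerivAt (fun s : ℝ => y + s • (x - y)) (x - y) s := by
      simpa using ((hasDerivAt_id s).smul_const (x - y)).const_add y
    have h2 := ((hf.differentiable one_ne_zero) (y + s • (x - y))).hasFDerivAt.comp_hasDerivAt s h1
    simpa using (hasDerivAt_const s (x - y)).inner ℝ h2
  have := (convex_Icc (0 : ℝ) 1).image_sub_le_mul_sub_of_deriv_le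
    (f := fun s : ℝ => inner ℝ (x - y) (f (y + s • (x - y))))
    (fun s _ => (hd s).continuousAt.continuousWithinAt)
    (fun s _ => (hd s).differentiableAt.differentiableWithinAt)
    (C := b * ‖x - y‖ ^ 2)
    (by
      intro s hs
      rw [(hd s).deriv]
      exact hb _ (hS.add_smul_sub_mem hy hx (interior_subset hs)) _)
    0 (by simp) 1 (by simp) zero_le_one
  simpa [inner_sub_right] using this

theorem gronwall_piece {n : ℕ} (f : EuclideanSpace ℝ (Fin n) → EuclideanSpace ℝ (Fin n))
    (b a c : ℝ) (u w : ℝ → EuclideanSpace ℝ (Fin n))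
    (hu : ∀ s, HasDerivAt u (f (u s)) s) (hw : ∀ s, HasDerivAt w (f (w s)) s)
    (h : ∀ s ∈ Icc a c, inner ℝ (u s - w s) (f (u s) - f (w s)) ≤ b * ‖u s - w s‖ ^ 2)
    (s : ℝ) (hs : s ∈ Icc a c) :
    ‖u s - w s‖ ≤ ‖u a - w a‖ * Real.exp (b * (s - a)) := by
  have hd : ∀ s, HasDerivAt (fun s => ‖u s - w s‖ ^ 2 * Real.exp (-(2 * b * (s - a))))
      (2 * inner ℝ (u s - w s) (f (u s) - f (w s)) * Real.exp (-(2 * b * (s - a))) +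
        ‖u s - w s‖ ^ 2 * (Real.exp (-(2 * b * (s - a))) * (-(2 * b)))) s := by
    intro s
    have h1 := ((hu s).sub (hw s)).norm_sq
    have h2 : HasDerivAt (fun s => -(2 * b * (s - a))) (-(2 * b)) s := by
      simpa using (((hasDerivAt_id s).sub_const a).const_mul (2 * b)).fun_neg
    exact h1.mul h2.exp
  have hanti := antitoneOn_of_deriv_nonpos (convex_Icc a c)
    (f := fun s => ‖u s - w s‖ ^ 2 * Real.exp (-(2 * b * (s - a))))
    (fun s _ => (hd s).continuousAt.continuousWithinAt)
    (fun s _ => (hd s).differentiableAt.differentiableWithinAt)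
    (by
      intro s hs
      rw [(hd s).deriv]
      have := h s (interior_subset hs)
      have he := Real.exp_pos (-(2 * b * (s - a)))
      nlinarith)
  have h3 := hanti (left_mem_Icc.2 (hs.1.trans hs.2)) hs hs.1
  simp only [sub_self, mul_zero, neg_zero, Real.exp_zero, mul_one] at h3
  refine (sq_le_sq₀ (norm_nonneg _) (by positivity)).1 ?_
  rw [mul_pow, ← Real.exp_nat_mul]
  rw [Real.exp_neg, ← div_eq_mul_inv, div_le_iff₀ (Real.exp_pos _)] at h3
  convert h3 using 3
  push_cast
  ring

/-- **Piece-wise exponential local discrepancy function.** Let `f : ℝⁿ → ℝⁿ` be `C¹` with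
Jacobian `J`, let `0 = t₀ < t₁ < … < t_k = T` be a partition, and for each `i ∈ {1,…,k}`
let `Sᵢ` be convex with `J(x) + J(x)ᵀ ⪯ 2bᵢ·I` on `Sᵢ`.  If two trajectories of `ẋ = f(x)`
start at time `t₀ = 0` from `x₁` and `x₂` and both lie in `Sᵢ` throughout `[t_{i−1},t_i]`,
then for each `i` and every `t ∈ [t_{i−1},t_i]`,
`‖ξ(x₁,t) − ξ(x₂,t)‖ ≤ ‖x₁ − x₂‖·exp(bᵢ(t−t_{i−1}) + Σ_{j=1}^{i−1} bⱼ(tⱼ−t_{j−1}))`. -/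
theorem piecewise_exponential_discrepancy
    {n : ℕ} (f : EuclideanSpace ℝ (Fin n) → EuclideanSpace ℝ (Fin n))
    (J : EuclideanSpace ℝ (Fin n) → Matrix (Fin n) (Fin n) ℝ)
    (hf : ContDiff ℝ 1 f)
    (hJ : ∀ x v : EuclideanSpace ℝ (Fin n), fderiv ℝ f x v = (J x).mulVec v)
    (k : ℕ) (hk : 0 < k) (t : ℕ → ℝ) (T : ℝ)
    (ht0 : t 0 = 0) (htk : t k = T)
    (htmono : ∀ i < k, t i < t (i + 1))
    (S : ℕ → Set (EuclideanSpace ℝ (Fin n)))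
    (hS : ∀ i, 1 ≤ i → i ≤ k → Convex ℝ (S i))
    (b : ℕ → ℝ)
    (hb : ∀ i, 1 ≤ i → i ≤ k → ∀ x ∈ S i, ∀ v : EuclideanSpace ℝ (Fin n),
      v ⬝ᵥ (J x + (J x)ᵀ).mulVec v ≤ 2 * b i * ‖v‖ ^ 2)
    (ξ : EuclideanSpace ℝ (Fin n) → ℝ → EuclideanSpace ℝ (Fin n))
    (x₁ x₂ : EuclideanSpace ℝ (Fin n))
    (hξ₁ : ∀ s : ℝ, HasDerivAt (ξ x₁) (f (ξ x₁ s)) s)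
    (hξ₂ : ∀ s : ℝ, HasDerivAt (ξ x₂) (f (ξ x₂ s)) s)
    (hinit₁ : ξ x₁ (t 0) = x₁) (hinit₂ : ξ x₂ (t 0) = x₂)
    (hin₁ : ∀ i, 1 ≤ i → i ≤ k → ∀ s ∈ Icc (t (i - 1)) (t i), ξ x₁ s ∈ S i)
    (hin₂ : ∀ i, 1 ≤ i → i ≤ k → ∀ s ∈ Icc (t (i - 1)) (t i), ξ x₂ s ∈ S i) :
    ∀ i, 1 ≤ i → i ≤ k → ∀ s ∈ Icc (t (i - 1)) (t i),
      ‖ξ x₁ s - ξ x₂ s‖ ≤ ‖x₁ - x₂‖ *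
        Real.exp (b i * (s - t (i - 1)) +
          ∑ j ∈ Finset.Ico 1 i, b j * (t j - t (j - 1))) := by
  have hinner : ∀ i, 1 ≤ i → i ≤ k → ∀ x ∈ S i, ∀ v : EuclideanSpace ℝ (Fin n),
      inner ℝ v (fderiv ℝ f x v) ≤ b i * ‖v‖ ^ 2 := by
    intro i h1 h2 x hx v
    have h := hb i h1 h2 x hx v
    have e : inner ℝ v (fderiv ℝ f x v) = v ⬝ᵥ (J x).mulVec v := by
      rw [EuclideanSpace.inner_eq_star_dotProduct, hJ, dotProduct_comm]
      simp
    rw [Matrix.add_mulVec, dotProduct_add, Matrix.mulVec_transpose,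
      dotProduct_comm _ (Matrix.vecMul _ _), ← Matrix.dotProduct_mulVec] at h
    rw [e]
    linarith
  have step : ∀ i, 1 ≤ i → i ≤ k → ∀ s ∈ Icc (t (i - 1)) (t i),
      ‖ξ x₁ s - ξ x₂ s‖ ≤ ‖ξ x₁ (t (i - 1)) - ξ x₂ (t (i - 1))‖ *
        Real.exp (b i * (s - t (i - 1))) := by
    intro i h1 h2
    exact gronwall_piece f (b i) _ _ _ _ hξ₁ hξ₂ fun s hs =>
      one_sided_lip f hf (S i) (hS i h1 h2) (b i) (hinner i h1 h2) _ _
        (hin₁ i h1 h2 s hs) (hin₂ i h1 h2 s hs)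
  have nodes : ∀ m, m ≤ k → ‖ξ x₁ (t m) - ξ x₂ (t m)‖ ≤ ‖x₁ - x₂‖ *
      Real.exp (∑ j ∈ Finset.Ico 1 (m + 1), b j * (t j - t (j - 1))) := by
    intro m
    induction m with
    | zero => intro _; simp [hinit₁, hinit₂]
    | succ m ih =>
      intro hm
      have h := step (m + 1) (by omega) hm (t (m + 1))
        (right_mem_Icc.2 (htmono m (by omega)).le)
      rw [Finset.sum_Ico_succ_top (by omega), Real.exp_add, ← mul_assoc]
      refine h.trans ?_
      simp only [Nat.add_sub_cancel]
      gcongr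
      exact ih (by omega)
  intro i h1 h2 s hs
  obtain ⟨m, rfl⟩ : ∃ m, i = m + 1 := ⟨i - 1, by omega⟩
  refine (step _ h1 h2 s hs).trans ?_
  rw [add_comm (b _ * _), Real.exp_add, ← mul_assoc]
  gcongr
  exact nodes m (by omega)
end

section
/- Let f : ℝ^n → ℝ^n be continuously differentiable with Jacobian J_f, let P be an invertible n×n real matrix with condition number K = ‖P‖·‖P^{-1}‖ (spectral norms), and define the transformed Jacobian J̃_f(x) = P J_f(x) P^{-1}. Let S ⊆ ℝ^n be a convex set and λ̃ ∈ ℝ a constant such that J̃_f(x) + J̃_f(x)ᵀ ⪯ 2λ̃·I for every x ∈ S. Let ξ(x₁,·) and ξ(x₂,·) be two trajectories of ẋ = f(x) starting at time t₀ from x₁, x₂ which both remain in S for all t ∈ [t₀,t₁]. Then for every t ∈ [t₀,t₁], ‖ξ(x₁,t) − ξ(x₂,t)‖ ≤ K · ‖x₁ − x₂‖ · e^{λ̃(t−t₀)}. -/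
open Set
open scoped Matrix

/-- **Discrepancy bound after a linear coordinate transformation.** Let `f : ℝⁿ → ℝⁿ` be
`C¹` with Jacobian `J`, let `P` be an invertible real matrix with condition number
`K = ‖P‖·‖P⁻¹‖` (spectral norms), and put `J̃(x) = P J(x) P⁻¹`.  Let `S` be convex with
`J̃(x) + J̃(x)ᵀ ⪯ 2λ̃·I` on `S`.  If two trajectories of `ẋ = f(x)` start at time `t₀`
from `x₁`, `x₂` and remain in `S` on `[t₀,t₁]`, then for every `t ∈ [t₀,t₁]`,
`‖ξ(x₁,t) − ξ(x₂,t)‖ ≤ K·‖x₁ − x₂‖·e^{λ̃(t−t₀)}`. -/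
theorem discrepancy_with_coordinate_transformation
    {n : ℕ} (f : EuclideanSpace ℝ (Fin n) → EuclideanSpace ℝ (Fin n))
    (J : EuclideanSpace ℝ (Fin n) → Matrix (Fin n) (Fin n) ℝ)
    (hf : ContDiff ℝ 1 f)
    (hJ : ∀ x v : EuclideanSpace ℝ (Fin n), fderiv ℝ f x v = (J x).mulVec v)
    (P : Matrix (Fin n) (Fin n) ℝ) (hP : IsUnit P.det)
    (S : Set (EuclideanSpace ℝ (Fin n))) (hS : Convex ℝ S)
    (lam : ℝ)
    (hlam : ∀ x ∈ S, ∀ v : EuclideanSpace ℝ (Fin n),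
      v ⬝ᵥ (P * J x * P⁻¹ + (P * J x * P⁻¹)ᵀ).mulVec v ≤ 2 * lam * ‖v‖ ^ 2)
    (ξ : EuclideanSpace ℝ (Fin n) → ℝ → EuclideanSpace ℝ (Fin n))
    (x₁ x₂ : EuclideanSpace ℝ (Fin n))
    (hξ₁ : ∀ s : ℝ, HasDerivAt (ξ x₁) (f (ξ x₁ s)) s)
    (hξ₂ : ∀ s : ℝ, HasDerivAt (ξ x₂) (f (ξ x₂ s)) s)
    (t₀ t₁ : ℝ)
    (hinit₁ : ξ x₁ t₀ = x₁) (hinit₂ : ξ x₂ t₀ = x₂)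
    (hS₁ : ∀ s ∈ Icc t₀ t₁, ξ x₁ s ∈ S)
    (hS₂ : ∀ s ∈ Icc t₀ t₁, ξ x₂ s ∈ S) :
    ∀ s ∈ Icc t₀ t₁,
      ‖ξ x₁ s - ξ x₂ s‖ ≤
        (‖Matrix.toEuclideanCLM (𝕜 := ℝ) P‖ * ‖Matrix.toEuclideanCLM (𝕜 := ℝ) P⁻¹‖) *
          ‖x₁ - x₂‖ * Real.exp (lam * (s - t₀)) := by
  have hmul : ∀ (M : Matrix (Fin n) (Fin n) ℝ) (v : EuclideanSpace ℝ (Fin n)),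
      (Matrix.toEuclideanCLM (𝕜 := ℝ) M v).ofLp = M.mulVec v.ofLp := fun M v => by
    simp
  have hinn : ∀ u v : EuclideanSpace ℝ (Fin n), inner ℝ u v = u.ofLp ⬝ᵥ v.ofLp := fun u v => by
    rw [EuclideanSpace.inner_eq_star_dotProduct, dotProduct_comm]; simp
  set L := Matrix.toEuclideanCLM (𝕜 := ℝ) P with hL
  set L' := Matrix.toEuclideanCLM (𝕜 := ℝ) P⁻¹ with hL'
  have hinv : ∀ w, L' (L w) = w := by
    intro w
    apply (WithLp.ofLp_injective 2)
    rw [hL', hmul, hL, hmul, Matrix.mulVec_mulVec, Matrix.nonsing_inv_mul _ hP, Matrix.one_mulVec]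
  have hpt : ∀ x ∈ S, ∀ w, inner ℝ (L w) (L (fderiv ℝ f x w)) ≤ lam * ‖L w‖ ^ 2 := by
    intro x hx w
    have h1 := hlam x hx (L w)
    have h2 : (P * J x * P⁻¹).mulVec (L w).ofLp = (L (fderiv ℝ f x w)).ofLp := by
      rw [hL, hmul, hmul, hJ, Matrix.mulVec_mulVec, Matrix.mulVec_mulVec]
      rw [Matrix.mul_assoc (P * J x), Matrix.nonsing_inv_mul _ hP, Matrix.mul_one]
    rw [Matrix.add_mulVec, dotProduct_add, Matrix.mulVec_transpose,
      dotProduct_comm _ (Matrix.vecMul _ _), ← Matrix.dotProduct_mulVec, h2] at h1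
    rw [hinn]
    linarith
  have hfd : Differentiable ℝ f := hf.differentiable (by norm_num)
  have hmvt : ∀ a ∈ S, ∀ b ∈ S,
      inner ℝ (L (a - b)) (L (f a - f b)) ≤ lam * ‖L (a - b)‖ ^ 2 := by
    intro a ha b hb
    have hd : ∀ τ : ℝ, HasDerivAt (fun τ : ℝ => inner ℝ (L (a - b)) (L (f (b + τ • (a - b)))))
        (inner ℝ (L (a - b)) (L (fderiv ℝ f (b + τ • (a - b)) (a - b)))) τ := by
      intro τ
      have h0 : HasDerivAt (fun τ : ℝ => b + τ • (a - b)) (a - b) τ := by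
        simpa using ((hasDerivAt_id τ).smul_const (a - b)).const_add b
      have h1 := (hfd (b + τ • (a - b))).hasFDerivAt.comp_hasDerivAt τ h0
      have h2 := L.hasFDerivAt.comp_hasDerivAt τ h1
      exact ((innerSL ℝ (L (a - b))).hasFDerivAt.comp_hasDerivAt τ h2)
    obtain ⟨c, hc, hceq⟩ := exists_hasDerivAt_eq_slope _ _ (zero_lt_one (α := ℝ))
      (fun τ _ => (hd τ).continuousAt.continuousWithinAt) (fun τ _ => hd τ)
    have hcS : b + c • (a - b) ∈ S := hS.add_smul_sub_mem hb ha ⟨hc.1.le, hc.2.le⟩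
    have h3 := hpt _ hcS (a - b)
    rw [hceq] at h3
    simp only [one_smul, zero_smul, add_zero, sub_zero, div_one, add_sub_cancel] at h3
    rw [map_sub L (f a), inner_sub_right]
    exact h3
  have hg : ∀ s : ℝ, HasDerivAt
      (fun s => ‖L (ξ x₁ s - ξ x₂ s)‖ ^ 2 * Real.exp (-(2 * lam * (s - t₀))))
      ((2 * inner ℝ (L (ξ x₁ s - ξ x₂ s)) (L (f (ξ x₁ s) - f (ξ x₂ s)))) *
          Real.exp (-(2 * lam * (s - t₀))) + ‖L (ξ x₁ s - ξ x₂ s)‖ ^ 2 *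
          (Real.exp (-(2 * lam * (s - t₀))) * -(2 * lam))) s := by
    intro s
    have h1 := (L.hasFDerivAt.comp_hasDerivAt s ((hξ₁ s).sub (hξ₂ s))).norm_sq
    have h2 : HasDerivAt (fun s => -(2 * lam * (s - t₀))) (-(2 * lam)) s := by
      simpa using (((hasDerivAt_id s).sub_const t₀).const_mul (2 * lam)).fun_neg
    exact h1.mul h2.exp
  have hanti : AntitoneOn
      (fun s => ‖L (ξ x₁ s - ξ x₂ s)‖ ^ 2 * Real.exp (-(2 * lam * (s - t₀)))) (Icc t₀ t₁) := by
    apply antitoneOn_of_deriv_nonpos (convex_Icc _ _)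
    · exact fun s _ => (hg s).continuousAt.continuousWithinAt
    · exact fun s _ => (hg s).differentiableAt.differentiableWithinAt
    · intro s hs
      have hs := interior_subset hs
      rw [(hg s).deriv]
      have h := hmvt _ (hS₁ s hs) _ (hS₂ s hs)
      have he := Real.exp_pos (-(2 * lam * (s - t₀)))
      nlinarith [mul_le_mul_of_nonneg_right h he.le]
  intro s hs
  have h := hanti ⟨le_rfl, hs.1.trans hs.2⟩ hs hs.1
  simp only [hinit₁, hinit₂, sub_self, mul_zero, neg_zero, Real.exp_zero, mul_one] at h
  have hy : ‖L (ξ x₁ s - ξ x₂ s)‖ ≤ ‖L (x₁ - x₂)‖ * Real.exp (lam * (s - t₀)) := by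
    refine (sq_le_sq₀ (norm_nonneg _) (by positivity)).1 ?_
    have he : Real.exp (lam * (s - t₀)) ^ 2 * Real.exp (-(2 * lam * (s - t₀))) = 1 := by
      rw [← Real.exp_nat_mul, ← Real.exp_add, Real.exp_eq_one_iff]
      push_cast; ring
    rw [mul_pow]
    calc _ = ‖L (ξ x₁ s - ξ x₂ s)‖ ^ 2 * Real.exp (-(2 * lam * (s - t₀))) *
          Real.exp (lam * (s - t₀)) ^ 2 := by rw [mul_assoc, mul_comm (Real.exp _), he, mul_one]
      _ ≤ _ := by gcongr
  calc ‖ξ x₁ s - ξ x₂ s‖ = ‖L' (L (ξ x₁ s - ξ x₂ s))‖ := by rw [hinv]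
    _ ≤ ‖L'‖ * ‖L (ξ x₁ s - ξ x₂ s)‖ := L'.le_opNorm _
    _ ≤ ‖L'‖ * ((‖L‖ * ‖x₁ - x₂‖) * Real.exp (lam * (s - t₀))) := by
      gcongr
      exact hy.trans (by gcongr; exact L.le_opNorm _)
    _ = _ := by ring
end

section
/- Let f : ℝ^n × ℝ^p → ℝ^n be continuously differentiable with Jacobians J_x = ∂f/∂x and J_u = ∂f/∂u. Let u₁, u₂ be integrable input signals on [t₀,t₁] and let ξ(x,·), ξ(x',·) be the corresponding trajectories of ẋ = f(x,u) from x and x'. Suppose S ⊆ ℝ^n is convex and both trajectories remain in S on [t₀,t₁]; suppose λ ∈ ℝ satisfies J_x(z,u)ᵀ + J_x(z,u) ⪯ 2λ·I for all z ∈ S and all relevant input values u, and M ≥ 0 satisfies ‖J_u(z,u)‖ ≤ M on the same set. Set y(t) = ξ(x',t) − ξ(x,t) and v(t) = u₂(t) − u₁(t). Then for all t ∈ [t₀,t₁], the derivative of ‖y(t)‖² satisfies d/dt ‖y(t)‖² ≤ (2λ + 1)·‖y(t)‖² + M²·‖v(t)‖². -/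
open Set
open scoped Matrix

/-- **Differential inequality for the squared distance with inputs.** Let
`f : ℝⁿ × ℝᵖ → ℝⁿ` be `C¹` with partial Jacobians `J_x`, `J_u`.  Let `u₁, u₂` be input
signals, `ξ, ξ'` corresponding trajectories of `ẋ = f(x,u)` remaining in a convex set `S`
on `[t₀,t₁]`.  Suppose `J_x(z,u)ᵀ + J_x(z,u) ⪯ 2λ·I` and `‖J_u(z,u)‖ ≤ M` (spectral norm)
for all `z ∈ S` and all relevant input values `u` (points on the segment between `u₁(t)`
and `u₂(t)` for `t ∈ [t₀,t₁]`).  Then with `y(t) = ξ'(t) − ξ(t)` and `v(t) = u₂(t) − u₁(t)`,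
for all `t ∈ [t₀,t₁]`, `d/dt ‖y(t)‖² ≤ (2λ+1)‖y(t)‖² + M²‖v(t)‖²`. -/
theorem sq_dist_deriv_le_with_input
    {n p : ℕ}
    (f : EuclideanSpace ℝ (Fin n) → EuclideanSpace ℝ (Fin p) → EuclideanSpace ℝ (Fin n))
    (Jx : EuclideanSpace ℝ (Fin n) → EuclideanSpace ℝ (Fin p) → Matrix (Fin n) (Fin n) ℝ)
    (Ju : EuclideanSpace ℝ (Fin n) → EuclideanSpace ℝ (Fin p) → Matrix (Fin n) (Fin p) ℝ)
    (hf : ContDiff ℝ 1 (fun q : EuclideanSpace ℝ (Fin n) × EuclideanSpace ℝ (Fin p) =>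
      f q.1 q.2))
    (hJx : ∀ (z : EuclideanSpace ℝ (Fin n)) (u : EuclideanSpace ℝ (Fin p))
      (v : EuclideanSpace ℝ (Fin n)), fderiv ℝ (fun y => f y u) z v = (Jx z u).mulVec v)
    (hJu : ∀ (z : EuclideanSpace ℝ (Fin n)) (u : EuclideanSpace ℝ (Fin p))
      (w : EuclideanSpace ℝ (Fin p)), fderiv ℝ (fun z' => f z z') u w = (Ju z u).mulVec w)
    (u₁ u₂ : ℝ → EuclideanSpace ℝ (Fin p))
    (t₀ t₁ : ℝ)
    (S : Set (EuclideanSpace ℝ (Fin n))) (hS : Convex ℝ S)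
    (lam : ℝ) (M : ℝ) (hM0 : 0 ≤ M)
    (hlam : ∀ t ∈ Icc t₀ t₁, ∀ z ∈ S, ∀ s ∈ Icc (0:ℝ) 1,
      ∀ v : EuclideanSpace ℝ (Fin n),
        v ⬝ᵥ ((Jx z (u₁ t + s • (u₂ t - u₁ t)))ᵀ
            + Jx z (u₁ t + s • (u₂ t - u₁ t))).mulVec v ≤ 2 * lam * ‖v‖ ^ 2)
    (hMb : ∀ t ∈ Icc t₀ t₁, ∀ z ∈ S, ∀ s ∈ Icc (0:ℝ) 1,
      ‖LinearMap.toContinuousLinearMap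
        (Matrix.toEuclideanLin (Ju z (u₁ t + s • (u₂ t - u₁ t))))‖ ≤ M)
    (ξ ξ' : ℝ → EuclideanSpace ℝ (Fin n))
    (x x' : EuclideanSpace ℝ (Fin n))
    (hξ : ∀ t, HasDerivAt ξ (f (ξ t) (u₁ t)) t)
    (hξ' : ∀ t, HasDerivAt ξ' (f (ξ' t) (u₂ t)) t)
    (hinit : ξ t₀ = x) (hinit' : ξ' t₀ = x')
    (hin : ∀ t ∈ Icc t₀ t₁, ξ t ∈ S)
    (hin' : ∀ t ∈ Icc t₀ t₁, ξ' t ∈ S) :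
    ∀ t ∈ Icc t₀ t₁, ∀ d : ℝ,
      HasDerivAt (fun s => ‖ξ' s - ξ s‖ ^ 2) d t →
        d ≤ (2 * lam + 1) * ‖ξ' t - ξ t‖ ^ 2 + M ^ 2 * ‖u₂ t - u₁ t‖ ^ 2 := by
  intro t ht d hd
  have hd' := ((hξ' t).sub (hξ t)).norm_sq
  have hdeq := hd.unique hd'
  rw [hdeq]
  set y := ξ' t - ξ t with hy
  set v := u₂ t - u₁ t with hv
  simp only [Pi.sub_apply, ← hy]
  set F := (fun q : EuclideanSpace ℝ (Fin n) × EuclideanSpace ℝ (Fin p) => f q.1 q.2) with hF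
  have hFd : Differentiable ℝ F := hf.differentiable one_ne_zero
  let c : ℝ → EuclideanSpace ℝ (Fin n) × EuclideanSpace ℝ (Fin p) :=
    fun s => (ξ t + s • y, u₁ t + s • v)
  have hc : ∀ s, HasDerivAt c (y, v) s := by
    intro s
    have h1 : HasDerivAt (fun s : ℝ => ξ t + s • y) y s := by
      simpa using ((hasDerivAt_id s).smul_const y).const_add (ξ t)
    have h2 : HasDerivAt (fun s : ℝ => u₁ t + s • v) v s := by
      simpa using ((hasDerivAt_id s).smul_const v).const_add (u₁ t)
    exact h1.prodMk h2
  let g : ℝ → ℝ := fun s => inner ℝ y (F (c s))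
  have hg : ∀ s, HasDerivAt g (inner ℝ y (fderiv ℝ F (c s) (y, v))) s := by
    intro s
    have h1 := (hFd (c s)).hasFDerivAt.comp_hasDerivAt s (hc s)
    simpa using (hasDerivAt_const s y).inner ℝ h1
  have hsplit : ∀ z u, fderiv ℝ F (z, u) (y, v)
      = fderiv ℝ (fun y => f y u) z y + fderiv ℝ (fun z' => f z z') u v := by
    intro z u
    have h1 : HasFDerivAt (fun y => f y u) ((fderiv ℝ F (z, u)).comp
        (ContinuousLinearMap.inl ℝ _ _)) z :=
      HasFDerivAt.comp (g := F) (f := fun e => (e, u)) z (hFd (z, u)).hasFDerivAt (hasFDerivAt_prodMk_left z u)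
    have h2 : HasFDerivAt (fun w => f z w) ((fderiv ℝ F (z, u)).comp
        (ContinuousLinearMap.inr ℝ _ _)) u :=
      HasFDerivAt.comp (g := F) (f := fun e => (z, e)) u (hFd (z, u)).hasFDerivAt (hasFDerivAt_prodMk_right z u)
    rw [h1.fderiv, h2.fderiv]
    simp [← map_add]
  have hbound : ∀ s ∈ Icc (0:ℝ) 1,
      inner ℝ y (fderiv ℝ F (c s) (y, v)) ≤ lam * ‖y‖ ^ 2 + M * ‖y‖ * ‖v‖ := by
    intro s hs
    have hz : ξ t + s • y ∈ S := hS.add_smul_sub_mem (hin t ht) (hin' t ht) hs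
    have hl := hlam t ht _ hz s hs y
    have hm := hMb t ht _ hz s hs
    rw [hsplit, inner_add_right]
    have e1 : inner ℝ y (fderiv ℝ (fun y => f y (u₁ t + s • v)) (ξ t + s • y) y)
        ≤ lam * ‖y‖ ^ 2 := by
      rw [Matrix.add_mulVec, dotProduct_add, Matrix.mulVec_transpose,
        dotProduct_comm, ← Matrix.dotProduct_mulVec] at hl
      rw [EuclideanSpace.inner_eq_star_dotProduct, hJx, star_trivial, dotProduct_comm]
      linarith
    have e2 : inner ℝ y (fderiv ℝ (fun z' => f (ξ t + s • y) z') (u₁ t + s • v) v)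
        ≤ M * ‖y‖ * ‖v‖ := by
      have h3 : fderiv ℝ (fun z' => f (ξ t + s • y) z') (u₁ t + s • v) v =
          LinearMap.toContinuousLinearMap
            (Matrix.toEuclideanLin (Ju (ξ t + s • y) (u₁ t + s • v))) v := by
        ext i
        rw [hJu]
        rfl
      rw [h3]
      refine (real_inner_le_norm _ _).trans ?_
      have h4 := ContinuousLinearMap.le_of_opNorm_le _ hm v
      nlinarith [mul_le_mul_of_nonneg_left h4 (norm_nonneg y)]
    linarith
  obtain ⟨s, hs, hse⟩ := exists_hasDerivAt_eq_slope g _ (zero_lt_one)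
    (fun s _ => (hg s).continuousAt.continuousWithinAt) (fun s _ => hg s)
  have hb := hbound s (Ioo_subset_Icc_self hs)
  rw [hse] at hb
  have hg1 : g 1 = inner ℝ y (f (ξ' t) (u₂ t)) := by simp [g, c, F, hy, hv]
  have hg0 : g 0 = inner ℝ y (f (ξ t) (u₁ t)) := by simp [g, c, F]
  rw [hg1, hg0, sub_zero, div_one, ← inner_sub_right] at hb
  nlinarith [sq_nonneg (‖y‖ - M * ‖v‖)]
end

section
/- Let f : ℝ^n × ℝ^p → ℝ^n be continuously differentiable with Jacobians J_x = ∂f/∂x and J_u = ∂f/∂u. Let u₁, u₂ be integrable input signals on [t₀,t₁] and let ξ(x,·), ξ(x',·) be the corresponding trajectories of ẋ = f(x,u) from x and x'. Suppose S ⊆ ℝ^n is convex and both trajectories remain in S on [t₀,t₁]; suppose λ ∈ ℝ satisfies J_x(z,u)ᵀ + J_x(z,u) ⪯ 2λ·I for all z ∈ S and all relevant input values u, and M ≥ 0 satisfies ‖J_u(z,u)‖ ≤ M on the same set. Let a = λ + 1/2 and assume a ≥ 0. Then for every t ∈ [t₀,t₁], ‖ξ(x,t) − ξ(x',t)‖ ≤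 ‖x − x'‖·e^{a(t−t₀)} + M·e^{a(t−t₀)}·∫_{t₀}^{t} ‖u₁(τ) − u₂(τ)‖ dτ. -/
open Set
open scoped Matrix

/-- **One-step input-to-state discrepancy bound.** Let `f : ℝⁿ × ℝᵖ → ℝⁿ` be `C¹` with
partial Jacobians `J_x`, `J_u`.  Let `u₁, u₂` be integrable input signals and `ξ, ξ'` the
corresponding trajectories of `ẋ = f(x,u)` from `x` and `x'`, both remaining in a convex
set `S` on `[t₀,t₁]`.  Suppose `J_x(z,u)ᵀ + J_x(z,u) ⪯ 2λ·I` and `‖J_u(z,u)‖ ≤ M` for all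
`z ∈ S` and all relevant input values `u`, and let `a = λ + 1/2 ≥ 0`.  Then for every
`t ∈ [t₀,t₁]`,
`‖ξ(t) − ξ'(t)‖ ≤ ‖x − x'‖·e^{a(t−t₀)} + M·e^{a(t−t₀)}·∫_{t₀}^t ‖u₁(τ) − u₂(τ)‖ dτ`. -/
theorem input_to_state_discrepancy_one_step
    {n p : ℕ}
    (f : EuclideanSpace ℝ (Fin n) → EuclideanSpace ℝ (Fin p) → EuclideanSpace ℝ (Fin n))
    (Jx : EuclideanSpace ℝ (Fin n) → EuclideanSpace ℝ (Fin p) → Matrix (Fin n) (Fin n) ℝ)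
    (Ju : EuclideanSpace ℝ (Fin n) → EuclideanSpace ℝ (Fin p) → Matrix (Fin n) (Fin p) ℝ)
    (hf : ContDiff ℝ 1 (fun q : EuclideanSpace ℝ (Fin n) × EuclideanSpace ℝ (Fin p) =>
      f q.1 q.2))
    (hJx : ∀ (z : EuclideanSpace ℝ (Fin n)) (u : EuclideanSpace ℝ (Fin p))
      (v : EuclideanSpace ℝ (Fin n)), fderiv ℝ (fun y => f y u) z v = (Jx z u).mulVec v)
    (hJu : ∀ (z : EuclideanSpace ℝ (Fin n)) (u : EuclideanSpace ℝ (Fin p))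
      (w : EuclideanSpace ℝ (Fin p)), fderiv ℝ (fun z' => f z z') u w = (Ju z u).mulVec w)
    (u₁ u₂ : ℝ → EuclideanSpace ℝ (Fin p))
    (t₀ t₁ : ℝ)
    (hu : IntervalIntegrable (fun τ => ‖u₁ τ - u₂ τ‖) MeasureTheory.volume t₀ t₁)
    (S : Set (EuclideanSpace ℝ (Fin n))) (hS : Convex ℝ S)
    (lam : ℝ) (M : ℝ) (hM0 : 0 ≤ M)
    (hlam : ∀ t ∈ Icc t₀ t₁, ∀ z ∈ S, ∀ s ∈ Icc (0:ℝ) 1,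
      ∀ v : EuclideanSpace ℝ (Fin n),
        v ⬝ᵥ ((Jx z (u₁ t + s • (u₂ t - u₁ t)))ᵀ
            + Jx z (u₁ t + s • (u₂ t - u₁ t))).mulVec v ≤ 2 * lam * ‖v‖ ^ 2)
    (hMb : ∀ t ∈ Icc t₀ t₁, ∀ z ∈ S, ∀ s ∈ Icc (0:ℝ) 1,
      ‖LinearMap.toContinuousLinearMap
        (Matrix.toEuclideanLin (Ju z (u₁ t + s • (u₂ t - u₁ t))))‖ ≤ M)
    (a : ℝ) (ha : a = lam + 1 / 2) (ha0 : 0 ≤ a)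
    (ξ ξ' : ℝ → EuclideanSpace ℝ (Fin n))
    (x x' : EuclideanSpace ℝ (Fin n))
    (hξ : ∀ t, HasDerivAt ξ (f (ξ t) (u₁ t)) t)
    (hξ' : ∀ t, HasDerivAt ξ' (f (ξ' t) (u₂ t)) t)
    (hinit : ξ t₀ = x) (hinit' : ξ' t₀ = x')
    (hin : ∀ t ∈ Icc t₀ t₁, ξ t ∈ S)
    (hin' : ∀ t ∈ Icc t₀ t₁, ξ' t ∈ S) :
    ∀ t ∈ Icc t₀ t₁,
      ‖ξ t - ξ' t‖ ≤ ‖x - x'‖ * Real.exp (a * (t - t₀)) +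
        M * Real.exp (a * (t - t₀)) * ∫ τ in t₀..t, ‖u₁ τ - u₂ τ‖ := by
  intro t ht
  have hfd : Differentiable ℝ (fun q : EuclideanSpace ℝ (Fin n) × EuclideanSpace ℝ (Fin p) =>
      f q.1 q.2) := hf.differentiable (by norm_num)
  have hdx : ∀ u z, DifferentiableAt ℝ (fun y => f y u) z := fun u z =>
    (hfd (z, u)).comp z (f := fun y => (y, u)) (by fun_prop)
  have hdu : ∀ z u, DifferentiableAt ℝ (fun y => f z y) u := fun z u =>
    (hfd (z, u)).comp u (f := fun y => (z, y)) (by fun_prop)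
  -- pointwise estimate
  have key : ∀ r ∈ Icc t₀ t₁, inner ℝ (ξ r - ξ' r) (f (ξ r) (u₁ r) - f (ξ' r) (u₂ r)) ≤
      lam * ‖ξ r - ξ' r‖ ^ 2 + ‖ξ r - ξ' r‖ * (M * ‖u₁ r - u₂ r‖) := by
    intro r hr
    have hmono : inner ℝ (ξ r - ξ' r) (f (ξ r) (u₁ r) - f (ξ' r) (u₁ r)) ≤
        lam * ‖ξ r - ξ' r‖ ^ 2 := by
      set w := ξ r - ξ' r with hw
      have hseg : ∀ s ∈ Icc (0:ℝ) 1, ξ' r + s • w ∈ S := fun s hs =>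
        hS.add_smul_sub_mem (hin' r hr) (hin r hr) hs
      have hJ : ∀ z ∈ S, inner ℝ w (fderiv ℝ (fun y => f y (u₁ r)) z w) ≤ lam * ‖w‖ ^ 2 := by
        intro z hz
        have h1 := hlam r hr z hz 0 (by simp) w
        simp only [zero_smul, add_zero] at h1
        rw [Matrix.add_mulVec, dotProduct_add, Matrix.mulVec_transpose,
          dotProduct_comm, ← Matrix.dotProduct_mulVec] at h1
        rw [EuclideanSpace.inner_eq_star_dotProduct, hJx, star_trivial, dotProduct_comm]
        linarith
      have hder : ∀ s : ℝ, HasDerivAt (fun s : ℝ => inner ℝ w (f (ξ' r + s • w) (u₁ r)))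
          (inner ℝ w (fderiv ℝ (fun y => f y (u₁ r)) (ξ' r + s • w) w)) s := by
        intro s
        have h1 : HasDerivAt (fun s : ℝ => ξ' r + s • w) w s := by
          simpa using ((hasDerivAt_id s).smul_const w).const_add (ξ' r)
        have h2 := (hdx (u₁ r) (ξ' r + s • w)).hasFDerivAt.comp_hasDerivAt s h1
        have h3 := (hasDerivAt_const s w).inner ℝ h2
        simpa using h3
      have := Convex.image_sub_le_mul_sub_of_deriv_le (convex_Icc (0:ℝ) 1)
        (f := fun s : ℝ => inner ℝ w (f (ξ' r + s • w) (u₁ r)))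
        (fun s _ => (hder s).continuousAt.continuousWithinAt)
        (fun s _ => (hder s).differentiableAt.differentiableWithinAt)
        (C := lam * ‖w‖ ^ 2)
        (fun s hs => by
          rw [(hder s).deriv]
          exact hJ _ (hseg s (interior_subset hs)))
        0 (by simp) 1 (by simp) zero_le_one
      simp only [one_smul, zero_smul, add_zero, sub_zero, mul_one] at this
      rw [inner_sub_right]
      have e : ξ' r + w = ξ r := by rw [hw]; abel
      rwa [e] at this
    have hlip : ‖f (ξ' r) (u₁ r) - f (ξ' r) (u₂ r)‖ ≤ M * ‖u₁ r - u₂ r‖ := by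
      refine Convex.norm_image_sub_le_of_norm_fderiv_le (𝕜 := ℝ) (s := segment ℝ (u₁ r) (u₂ r))
        (f := fun y => f (ξ' r) y)
        (fun y _ => hdu _ y) ?_ (convex_segment _ _) (right_mem_segment _ _ _)
        (left_mem_segment _ _ _)
      intro y hy
      rw [segment_eq_image'] at hy
      obtain ⟨s, hs, rfl⟩ := hy
      refine le_trans (le_of_eq ?_) (hMb r hr (ξ' r) (hin' r hr) s hs)
      congr 1
      ext v i
      have := hJu (ξ' r) (u₁ r + s • (u₂ r - u₁ r)) v
      simpa using congrFun this i
    have hsplit : f (ξ r) (u₁ r) - f (ξ' r) (u₂ r) =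
      (f (ξ r) (u₁ r) - f (ξ' r) (u₁ r)) + (f (ξ' r) (u₁ r) - f (ξ' r) (u₂ r)) := by abel
    rw [hsplit, inner_add_right]
    refine add_le_add hmono ((real_inner_le_norm _ _).trans ?_)
    gcongr
  have hsub : ∀ r ∈ Icc t₀ t, r ∈ Icc t₀ t₁ := fun r hr => ⟨hr.1, hr.2.trans ht.2⟩
  set I := ∫ τ in t₀..t, ‖u₁ τ - u₂ τ‖ with hI
  -- regularised norm
  have main : ∀ ε > 0, ‖ξ t - ξ' t‖ ≤ Real.exp (a * (t - t₀)) * (‖x - x'‖ + ε + M * I) := by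
    intro ε hε
    set h : ℝ → ℝ := fun r => √(‖ξ r - ξ' r‖ ^ 2 + ε ^ 2) with hh
    have hpos : ∀ r, 0 < h r := fun r => Real.sqrt_pos.2 (by positivity)
    have hsq : ∀ r, h r ^ 2 = ‖ξ r - ξ' r‖ ^ 2 + ε ^ 2 := fun r => Real.sq_sqrt (by positivity)
    have hge : ∀ r, ‖ξ r - ξ' r‖ ≤ h r := fun r => Real.le_sqrt_of_sq_le (by nlinarith)
    have hle : h t₀ ≤ ‖x - x'‖ + ε := by
      rw [← hinit, ← hinit']
      refine Real.sqrt_le_iff.2 ⟨by positivity, ?_⟩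
      nlinarith [mul_nonneg (norm_nonneg (ξ t₀ - ξ' t₀)) hε.le]
    have hhd : ∀ r, HasDerivAt h
        (inner ℝ (ξ r - ξ' r) (f (ξ r) (u₁ r) - f (ξ' r) (u₂ r)) / h r) r := by
      intro r
      have h1 := ((((hξ r).sub (hξ' r)).norm_sq).add_const (ε ^ 2)).sqrt (by
        have : 0 < ‖ξ r - ξ' r‖ ^ 2 + ε ^ 2 := by positivity
        exact this.ne')
      rw [mul_div_mul_left _ _ (two_ne_zero (α := ℝ))] at h1
      exact h1
    have hed : ∀ r, HasDerivAt (fun r => Real.exp (-a * (r - t₀)))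
        (Real.exp (-a * (r - t₀)) * (-a)) r := by
      intro r
      have h1 : HasDerivAt (fun r => -a * (r - t₀)) (-a) r := by
        simpa using ((hasDerivAt_id r).sub_const t₀).const_mul (-a)
      exact h1.exp
    have hG := fun r => (hed r).mul (hhd r)
    have hint : IntervalIntegrable (fun τ => M * ‖u₁ τ - u₂ τ‖) MeasureTheory.volume t₀ t :=
      (hu.mono_set (by
        rw [uIcc_of_le ht.1, uIcc_of_le (ht.1.trans ht.2)]
        exact hsub)).const_mul M
    have := intervalIntegral.sub_le_integral_of_hasDeriv_right_of_le ht.1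
      (fun r _ => (hG r).continuousAt.continuousWithinAt)
      (fun r _ => (hG r).hasDerivWithinAt)
      ((intervalIntegrable_iff_integrableOn_Icc_of_le ht.1).1 hint)
      (fun r hr => by
        have hr' : r ∈ Icc t₀ t := Ioo_subset_Icc_self hr
        have k := key r (hsub r hr')
        have hb : 0 ≤ M * ‖u₁ r - u₂ r‖ := by positivity
        have hd : inner ℝ (ξ r - ξ' r) (f (ξ r) (u₁ r) - f (ξ' r) (u₂ r)) / h r ≤
            a * h r + M * ‖u₁ r - u₂ r‖ := by
          rw [div_le_iff₀ (hpos r)]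
          have h1 : lam * ‖ξ r - ξ' r‖ ^ 2 ≤ a * ‖ξ r - ξ' r‖ ^ 2 := by
            gcongr
            linarith
          have h2 : a * ‖ξ r - ξ' r‖ ^ 2 ≤ a * h r ^ 2 := by
            rw [hsq]
            gcongr
            nlinarith
          have h3 := mul_le_mul_of_nonneg_right (hge r) hb
          nlinarith
        have he : Real.exp (-a * (r - t₀)) ≤ 1 := by
          rw [Real.exp_le_one_iff]
          nlinarith [mul_nonneg ha0 (sub_nonneg.2 hr'.1)]
        have hep := Real.exp_pos (-a * (r - t₀))
        calc _ = Real.exp (-a * (r - t₀)) *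
              (inner ℝ (ξ r - ξ' r) (f (ξ r) (u₁ r) - f (ξ' r) (u₂ r)) / h r - a * h r) := by ring
          _ ≤ Real.exp (-a * (r - t₀)) * (M * ‖u₁ r - u₂ r‖) := by
              gcongr
              linarith
          _ ≤ M * ‖u₁ r - u₂ r‖ := mul_le_of_le_one_left hb he)
    rw [intervalIntegral.integral_const_mul] at this
    simp only [Pi.mul_apply, sub_self, mul_zero, Real.exp_zero, one_mul] at this
    have h4 : Real.exp (-a * (t - t₀)) * h t ≤ ‖x - x'‖ + ε + M * I := by linarith
    calc ‖ξ t - ξ' t‖ ≤ h t := hge t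
      _ = Real.exp (a * (t - t₀)) * (Real.exp (-a * (t - t₀)) * h t) := by
          rw [← mul_assoc, ← Real.exp_add]
          simp
      _ ≤ _ := by gcongr
  refine le_of_forall_pos_le_add fun δ hδ => ?_
  have hE := Real.exp_pos (a * (t - t₀))
  have := main (δ / Real.exp (a * (t - t₀))) (by positivity)
  refine this.trans (le_of_eq ?_)
  field_simp
  ring
end

section
/- Let f : ℝ^n × ℝ^p → ℝ^n be continuously differentiable with Jacobians J_x = ∂f/∂x and J_u = ∂f/∂u, let 0 = t₀ < t₁ < … < t_k = T be a partition, and for each i ∈ {1,…,k} let S_i ⊆ ℝ^n be convex and a_i ≥ 0, M_i ≥ 0 be constants such that J_x(z,u)ᵀ + J_x(z,u) ⪯ (2a_i − 1)·I and ‖J_u(z,u)‖ ≤ M_i for all z ∈ S_i and all relevant input values u. Let u₁, u₂ be integrable input signals and ξ(x₁,·), ξ(x₂,·) the corresponding trajectories from x₁ and x₂, and suppose both trajectories lie in S_i for all t ∈ [t_{i−1},t_i] and each i. Define α recursively by α(t₀) = ‖x₁ − x₂‖ and, for t ∈ (t_{i−1},t_i], α(t) = α(t_{i−1})·e^{a_i(t−t_{i−1})}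 + M_i·e^{a_i(t−t_{i−1})}·∫_{t_{i−1}}^{t} ‖u₁(τ) − u₂(τ)‖ dτ. Then for every t ∈ [0,T], ‖ξ(x₁,t) − ξ(x₂,t)‖ ≤ α(t). -/
open Set
open scoped Matrix

theorem aux_gronwall {E : Type*} [NormedAddCommGroup E] [InnerProductSpace ℝ E]
    (d d' : ℝ → E) (w : ℝ → ℝ) (a M s r : ℝ) (hsr : s ≤ r) (ha : 0 ≤ a) (hM : 0 ≤ M)
    (hd : ∀ τ, HasDerivAt d (d' τ) τ) (hw0 : ∀ τ, 0 ≤ w τ)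
    (hw : IntervalIntegrable w MeasureTheory.volume s r)
    (hin : ∀ τ ∈ Icc s r, inner ℝ (d τ) (d' τ) ≤ a * ‖d τ‖ ^ 2 + M * w τ * ‖d τ‖) :
    ‖d r‖ ≤ ‖d s‖ * Real.exp (a * (r - s)) +
      M * Real.exp (a * (r - s)) * ∫ σ in s..r, w σ := by
  have key : ∀ ε : ℝ, 0 < ε → ‖d r‖ * Real.exp (-(a * (r - s))) ≤
      ‖d s‖ + M * (∫ σ in s..r, w σ) + ε := by
    intro ε hε
    have hpos : ∀ τ, 0 < ‖d τ‖ ^ 2 + ε ^ 2 := fun τ => by positivity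
    set h : ℝ → ℝ := fun τ => Real.sqrt (‖d τ‖ ^ 2 + ε ^ 2) with hh
    have hder : ∀ τ, HasDerivAt (fun τ => h τ * Real.exp (-(a * (τ - s))))
        ((2 * inner ℝ (d τ) (d' τ)) / (2 * h τ) * Real.exp (-(a * (τ - s))) +
          h τ * (Real.exp (-(a * (τ - s))) * (-(a * 1)))) τ := by
      intro τ
      have h1 : HasDerivAt h ((2 * inner ℝ (d τ) (d' τ)) / (2 * h τ)) τ :=
        (((hd τ).norm_sq).add_const (ε ^ 2)).sqrt (hpos τ).ne'
      have h2 : HasDerivAt (fun τ => Real.exp (-(a * (τ - s))))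
          (Real.exp (-(a * (τ - s))) * (-(a * 1))) τ :=
        ((((hasDerivAt_id τ).sub_const s).const_mul a).neg).exp
      exact h1.mul h2
    have hmain := intervalIntegral.sub_le_integral_of_hasDeriv_right_of_le (φ := fun τ => M * w τ) hsr
      (fun τ _ => (hder τ).continuousAt.continuousWithinAt)
      (fun τ _ => (hder τ).hasDerivWithinAt)
      (by
        have := (hw.const_mul M)
        rwa [intervalIntegrable_iff_integrableOn_Icc_of_le hsr] at this)
      (by
        intro τ hτ
        have hi := hin τ ⟨hτ.1.le, hτ.2.le⟩
        have hp : 0 < h τ := Real.sqrt_pos.2 (hpos τ)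
        have hsq : h τ ^ 2 = ‖d τ‖ ^ 2 + ε ^ 2 := Real.sq_sqrt (hpos τ).le
        have hle : ‖d τ‖ ≤ h τ := Real.le_sqrt_of_sq_le (by nlinarith)
        have hMw : 0 ≤ M * w τ := mul_nonneg hM (hw0 τ)
        have he1 : Real.exp (-(a * (τ - s))) ≤ 1 :=
          Real.exp_le_one_iff.2 (by nlinarith [mul_nonneg ha (sub_nonneg.2 hτ.1.le)])
        have he0 := Real.exp_pos (-(a * (τ - s)))
        have h3 : (2 * inner ℝ (d τ) (d' τ)) / (2 * h τ) ≤ a * h τ + M * w τ := by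
          rw [div_le_iff₀ (by positivity)]
          nlinarith [mul_le_mul_of_nonneg_left hle hMw, mul_nonneg ha (sq_nonneg ε)]
        nlinarith [mul_le_mul_of_nonneg_right h3 he0.le, mul_le_mul_of_nonneg_left he1 hMw])
    rw [intervalIntegral.integral_const_mul] at hmain
    simp only [sub_self, mul_zero, neg_zero, Real.exp_zero, mul_one] at hmain
    have h4 : h s ≤ ‖d s‖ + ε := by
      apply Real.sqrt_le_iff.2
      constructor
      · positivity
      · nlinarith [mul_nonneg (norm_nonneg (d s)) hε.le]
    have h5 : ‖d r‖ ≤ h r := Real.le_sqrt_of_sq_le (by nlinarith [sq_nonneg ε])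
    have h6 := mul_le_mul_of_nonneg_right h5 (Real.exp_pos (-(a * (r - s)))).le
    linarith
  have h7 := le_of_forall_pos_le_add key
  have h8 := mul_le_mul_of_nonneg_right h7 (Real.exp_pos (a * (r - s))).le
  rw [mul_assoc, ← Real.exp_add, neg_add_cancel, Real.exp_zero, mul_one] at h8
  linarith

theorem aux_first {E : Type*} [NormedAddCommGroup E] [InnerProductSpace ℝ E]
    (g : E → E) (hg : Differentiable ℝ g) (S : Set E) (hS : Convex ℝ S) (c : ℝ)
    (hb : ∀ z ∈ S, ∀ v, inner ℝ v (fderiv ℝ g z v) ≤ c * ‖v‖ ^ 2)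
    (x y : E) (hx : x ∈ S) (hy : y ∈ S) :
    inner ℝ (x - y) (g x - g y) ≤ c * ‖x - y‖ ^ 2 := by
  have hder : ∀ s : ℝ, HasDerivAt (fun s : ℝ => inner ℝ (x - y) (g (y + s • (x - y))))
      (inner ℝ (x - y) (fderiv ℝ g (y + s • (x - y)) (x - y))) s := by
    intro s
    have h1 : HasDerivAt (fun s : ℝ => y + s • (x - y)) (x - y) s := by
      simpa using ((hasDerivAt_id s).smul_const (x - y)).const_add y
    have h2 := (hg (y + s • (x - y))).hasFDerivAt.comp_hasDerivAt s h1
    simpa using (hasDerivAt_const s (x - y)).inner ℝ h2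
  have := (convex_Icc (0:ℝ) 1).image_sub_le_mul_sub_of_deriv_le
    (f := fun s : ℝ => inner ℝ (x - y) (g (y + s • (x - y))))
    (fun s _ => (hder s).continuousAt.continuousWithinAt)
    (fun s _ => (hder s).differentiableAt.differentiableWithinAt)
    (C := c * ‖x - y‖ ^ 2)
    (by
      intro s hs
      rw [(hder s).deriv]
      exact hb _ (hS.add_smul_sub_mem hy hx (interior_subset hs)) _)
    0 (by simp) 1 (by simp) zero_le_one
  simpa [inner_sub_right] using this

theorem aux_second {E F : Type*} [NormedAddCommGroup E] [NormedSpace ℝ E]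
    [NormedAddCommGroup F] [NormedSpace ℝ F]
    (g : F → E) (hg : Differentiable ℝ g) (M : ℝ) (p q : F)
    (hb : ∀ s ∈ Icc (0:ℝ) 1, ‖fderiv ℝ g (p + s • (q - p))‖ ≤ M) :
    ‖g p - g q‖ ≤ M * ‖p - q‖ := by
  apply (convex_segment p q).norm_image_sub_le_of_norm_fderiv_le (𝕜 := ℝ)
    (fun x _ => hg x) _ (right_mem_segment ℝ p q) (left_mem_segment ℝ p q)
  intro x hx
  rw [segment_eq_image'] at hx
  obtain ⟨s, hs, rfl⟩ := hx
  exact hb s hs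

/-- **Piece-wise input-to-state discrepancy function.** Let `f : ℝⁿ × ℝᵖ → ℝⁿ` be `C¹`
with partial Jacobians `J_x`, `J_u`, let `0 = t₀ < t₁ < … < t_k = T` be a partition, and
for each `i ∈ {1,…,k}` let `Sᵢ` be convex and `aᵢ, Mᵢ ≥ 0` satisfy
`J_x(z,u)ᵀ + J_x(z,u) ⪯ (2aᵢ − 1)·I` and `‖J_u(z,u)‖ ≤ Mᵢ` for all `z ∈ Sᵢ` and all
relevant input values `u`.  Let `ξ₁, ξ₂` be trajectories of `ẋ = f(x,u)` from `x₁, x₂`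
under integrable inputs `u₁, u₂`, both lying in `Sᵢ` throughout `[t_{i−1},t_i]`.  Define
`α` recursively by `α(t₀) = ‖x₁ − x₂‖` and, for `t ∈ (t_{i−1},t_i]`,
`α(t) = α(t_{i−1})·e^{aᵢ(t−t_{i−1})} + Mᵢ·e^{aᵢ(t−t_{i−1})}·∫_{t_{i−1}}^t ‖u₁ − u₂‖`.
Then `‖ξ₁(t) − ξ₂(t)‖ ≤ α(t)` for every `t ∈ [0,T]`. -/
theorem piecewise_input_to_state_discrepancy
    {n p : ℕ}
    (f : EuclideanSpace ℝ (Fin n) → EuclideanSpace ℝ (Fin p) → EuclideanSpace ℝ (Fin n))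
    (Jx : EuclideanSpace ℝ (Fin n) → EuclideanSpace ℝ (Fin p) → Matrix (Fin n) (Fin n) ℝ)
    (Ju : EuclideanSpace ℝ (Fin n) → EuclideanSpace ℝ (Fin p) → Matrix (Fin n) (Fin p) ℝ)
    (hf : ContDiff ℝ 1 (fun q : EuclideanSpace ℝ (Fin n) × EuclideanSpace ℝ (Fin p) =>
      f q.1 q.2))
    (hJx : ∀ (z : EuclideanSpace ℝ (Fin n)) (u : EuclideanSpace ℝ (Fin p))
      (v : EuclideanSpace ℝ (Fin n)), fderiv ℝ (fun y => f y u) z v = (Jx z u).mulVec v)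
    (hJu : ∀ (z : EuclideanSpace ℝ (Fin n)) (u : EuclideanSpace ℝ (Fin p))
      (w : EuclideanSpace ℝ (Fin p)), fderiv ℝ (fun z' => f z z') u w = (Ju z u).mulVec w)
    (k : ℕ) (hk : 0 < k) (t : ℕ → ℝ) (T : ℝ)
    (ht0 : t 0 = 0) (htk : t k = T)
    (htmono : ∀ i < k, t i < t (i + 1))
    (u₁ u₂ : ℝ → EuclideanSpace ℝ (Fin p))
    (hu : IntervalIntegrable (fun τ => ‖u₁ τ - u₂ τ‖) MeasureTheory.volume 0 T)
    (S : ℕ → Set (EuclideanSpace ℝ (Fin n)))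
    (hS : ∀ i, 1 ≤ i → i ≤ k → Convex ℝ (S i))
    (a M : ℕ → ℝ)
    (ha0 : ∀ i, 1 ≤ i → i ≤ k → 0 ≤ a i)
    (hM0 : ∀ i, 1 ≤ i → i ≤ k → 0 ≤ M i)
    (hlam : ∀ i, 1 ≤ i → i ≤ k → ∀ τ ∈ Icc (t (i - 1)) (t i), ∀ z ∈ S i,
      ∀ s ∈ Icc (0:ℝ) 1, ∀ v : EuclideanSpace ℝ (Fin n),
        v ⬝ᵥ ((Jx z (u₁ τ + s • (u₂ τ - u₁ τ)))ᵀ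
            + Jx z (u₁ τ + s • (u₂ τ - u₁ τ))).mulVec v ≤ (2 * a i - 1) * ‖v‖ ^ 2)
    (hMb : ∀ i, 1 ≤ i → i ≤ k → ∀ τ ∈ Icc (t (i - 1)) (t i), ∀ z ∈ S i,
      ∀ s ∈ Icc (0:ℝ) 1,
        ‖LinearMap.toContinuousLinearMap
          (Matrix.toEuclideanLin (Ju z (u₁ τ + s • (u₂ τ - u₁ τ))))‖ ≤ M i)
    (ξ₁ ξ₂ : ℝ → EuclideanSpace ℝ (Fin n))
    (x₁ x₂ : EuclideanSpace ℝ (Fin n))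
    (hξ₁ : ∀ τ, HasDerivAt ξ₁ (f (ξ₁ τ) (u₁ τ)) τ)
    (hξ₂ : ∀ τ, HasDerivAt ξ₂ (f (ξ₂ τ) (u₂ τ)) τ)
    (hinit₁ : ξ₁ (t 0) = x₁) (hinit₂ : ξ₂ (t 0) = x₂)
    (hin₁ : ∀ i, 1 ≤ i → i ≤ k → ∀ τ ∈ Icc (t (i - 1)) (t i), ξ₁ τ ∈ S i)
    (hin₂ : ∀ i, 1 ≤ i → i ≤ k → ∀ τ ∈ Icc (t (i - 1)) (t i), ξ₂ τ ∈ S i)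
    (α : ℝ → ℝ)
    (hα0 : α (t 0) = ‖x₁ - x₂‖)
    (hα : ∀ i, 1 ≤ i → i ≤ k → ∀ τ, t (i - 1) < τ → τ ≤ t i →
      α τ = α (t (i - 1)) * Real.exp (a i * (τ - t (i - 1))) +
        M i * Real.exp (a i * (τ - t (i - 1))) *
          ∫ σ in (t (i - 1))..τ, ‖u₁ σ - u₂ σ‖) :
    ∀ τ ∈ Icc (0:ℝ) T, ‖ξ₁ τ - ξ₂ τ‖ ≤ α τ := by
  have hk' : ∀ i ≤ k, t 0 ≤ t i := by
    intro i
    induction i with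
    | zero => simp
    | succ j ih => intro hj; exact (ih (by omega)).trans (htmono j (by omega)).le
  have hk'' : ∀ j ≤ k, t (k - j) ≤ t k := by
    intro j
    induction j with
    | zero => simp
    | succ j ih =>
      intro hj
      have h1 := htmono (k - (j + 1)) (by omega)
      rw [show k - (j + 1) + 1 = k - j by omega] at h1
      exact h1.le.trans (ih (by omega))
  have hTk : ∀ i ≤ k, t i ≤ t k := by
    intro i hi
    have := hk'' (k - i) (by omega)
    rwa [show k - (k - i) = i by omega] at this
  have hfx : ∀ u, Differentiable ℝ (fun y => f y u) := fun u =>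
    (hf.differentiable one_ne_zero).comp (differentiable_id.prodMk (differentiable_const u))
  have hfu : ∀ z, Differentiable ℝ (fun u => f z u) := fun z =>
    (hf.differentiable one_ne_zero).comp ((differentiable_const z).prodMk differentiable_id)
  -- one-piece bound
  have piece : ∀ i, 1 ≤ i → i ≤ k → ∀ r ∈ Icc (t (i - 1)) (t i),
      ‖ξ₁ r - ξ₂ r‖ ≤ ‖ξ₁ (t (i - 1)) - ξ₂ (t (i - 1))‖ * Real.exp (a i * (r - t (i - 1))) +
      M i * Real.exp (a i * (r - t (i - 1))) * ∫ σ in (t (i - 1))..r, ‖u₁ σ - u₂ σ‖ := by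
    intro i h1 hi r hr
    apply aux_gronwall (fun τ => ξ₁ τ - ξ₂ τ) (fun τ => f (ξ₁ τ) (u₁ τ) - f (ξ₂ τ) (u₂ τ))
      (fun σ => ‖u₁ σ - u₂ σ‖) (a i) (M i) (t (i - 1)) r hr.1 (ha0 i h1 hi) (hM0 i h1 hi)
      (fun τ => (hξ₁ τ).sub (hξ₂ τ)) (fun τ => norm_nonneg _)
    · apply hu.mono_set
      have e1 := hk' (i - 1) (by omega)
      have e2 := hTk i hi
      rw [uIcc_of_le hr.1, uIcc_of_le (by linarith [hr.1, hr.2])]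
      exact Icc_subset_Icc (by linarith) (by linarith [hr.2])
    · intro τ hτr
      have hτ : τ ∈ Icc (t (i - 1)) (t i) := ⟨hτr.1, hτr.2.trans hr.2⟩
      have A := aux_first (fun y => f y (u₁ τ)) (hfx _) (S i) (hS i h1 hi) (a i - 1 / 2)
        (by
          intro z hz v
          have h := hlam i h1 hi τ hτ z hz 0 (by simp) v
          have e : inner ℝ v (fderiv ℝ (fun y => f y (u₁ τ)) z v)
              = v ⬝ᵥ (Jx z (u₁ τ)).mulVec v := by
            rw [EuclideanSpace.inner_eq_star_dotProduct, hJx, star_trivial, dotProduct_comm]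
          rw [zero_smul, add_zero, Matrix.add_mulVec, dotProduct_add,
            Matrix.mulVec_transpose, dotProduct_comm, ← Matrix.dotProduct_mulVec] at h
          rw [e]
          linarith)
        (ξ₁ τ) (ξ₂ τ) (hin₁ i h1 hi τ hτ) (hin₂ i h1 hi τ hτ)
      have B := aux_second (fun u => f (ξ₂ τ) u) (hfu _) (M i) (u₁ τ) (u₂ τ)
        (by
          intro s hs
          have h := hMb i h1 hi τ hτ (ξ₂ τ) (hin₂ i h1 hi τ hτ) s hs
          convert h using 2
          ext w j
          have := congrFun (hJu (ξ₂ τ) (u₁ τ + s • (u₂ τ - u₁ τ)) w) j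
          simpa using this)
      have C := (real_inner_le_norm (ξ₁ τ - ξ₂ τ) (f (ξ₂ τ) (u₁ τ) - f (ξ₂ τ) (u₂ τ)))
      have D := mul_le_mul_of_nonneg_left B (norm_nonneg (ξ₁ τ - ξ₂ τ))
      have e : f (ξ₁ τ) (u₁ τ) - f (ξ₂ τ) (u₂ τ) = (f (ξ₁ τ) (u₁ τ) - f (ξ₂ τ) (u₁ τ)) +
        (f (ξ₂ τ) (u₁ τ) - f (ξ₂ τ) (u₂ τ)) := by abel
      beta_reduce at A B C D ⊢
      rw [e, inner_add_right]
      nlinarith [sq_nonneg ‖ξ₁ τ - ξ₂ τ‖]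
  have step : ∀ i, 1 ≤ i → i ≤ k → ‖ξ₁ (t (i - 1)) - ξ₂ (t (i - 1))‖ ≤ α (t (i - 1)) →
      ∀ r, t (i - 1) < r → r ≤ t i → ‖ξ₁ r - ξ₂ r‖ ≤ α r := by
    intro i h1 hi hb r hr1 hr2
    rw [hα i h1 hi r hr1 hr2]
    refine (piece i h1 hi r ⟨hr1.le, hr2⟩).trans ?_
    gcongr
  have all : ∀ i ≤ k, ∀ r ∈ Icc (t 0) (t i), ‖ξ₁ r - ξ₂ r‖ ≤ α r := by
    intro i
    induction i with
    | zero =>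
      intro _ r hr
      have : r = t 0 := le_antisymm hr.2 hr.1
      rw [this, hα0, hinit₁, hinit₂]
    | succ j ih =>
      intro hj r hr
      by_cases hrj : r ≤ t j
      · exact ih (by omega) r ⟨hr.1, hrj⟩
      · exact step (j + 1) (by omega) hj (ih (by omega) _ ⟨hk' j (by omega), le_rfl⟩) r
          (not_le.1 hrj) hr.2
  intro τ hτ
  exact all k le_rfl τ (by rw [ht0, htk]; exact hτ)
end
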